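/- For every fixed 0 ≤ p < 1, every θ > 0 and all 0 < t₁ < t₂, the zero-inflated negative binomial variables satisfy Z₁(t₁,θ,p) ≤cx Z₁(t₂,θ,p) and Z₂(t₁,θ,p) ≤cx Z₂(t₂,θ,p). -/

import Mathlib

open MeasureTheory Filter Topology ProbabilityTheory

noncomputable section

/-- `ConvexOrder μ ν` means the distribution `μ` is dominated by `ν` in the convex order:
`∫ φ dμ ≤ ∫ φ dν` for every convex function `φ : ℝ → ℝ` for which both integrals are
well defined. -/
def ConvexOrder (μ ν : Measure ℝ) : Prop :=
  ∀ φ : ℝ → ℝ, ConvexOn ℝ Set.univ φ → Integrable φ μ → Integrable φ ν →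
    ∫ x, φ x ∂μ ≤ ∫ x, φ x ∂ν

/-- The discrete measure on `ℝ` supported on the nonnegative integers with weights `w k`. -/
def discreteMeasure (w : ℕ → ℝ) : Measure ℝ :=
  Measure.sum fun k => ENNReal.ofReal (w k) • Measure.dirac (k : ℝ)

/-- The Poisson probabilities with mean `θ`. -/
def poissonPMFReal (θ : ℝ) (k : ℕ) : ℝ := Real.exp (-θ) * θ ^ k / k.factorial

/-- The Poisson distribution with mean `θ`, as a measure on `ℝ`. -/
def poissonMeasure (θ : ℝ) : Measure ℝ := discreteMeasure (poissonPMFReal θ)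

/-- The binomial probabilities with parameters `m` and `q`. -/
def binomialPMFReal (m : ℕ) (q : ℝ) (k : ℕ) : ℝ :=
  (m.choose k) * q ^ k * (1 - q) ^ (m - k)

/-- The binomial distribution with parameters `m` and `q`, as a measure on `ℝ`. -/
def binomialMeasure (m : ℕ) (q : ℝ) : Measure ℝ := discreteMeasure (binomialPMFReal m q)

/-- The negative binomial probabilities: `P(Z(t,θ) = k) =
(Γ(k + 1/t)/(k! Γ(1/t))) (θt)^k / (1 + θt)^(k + 1/t)`; this distribution has mean `θ`. -/
def negBinomialPMFReal (t θ : ℝ) (k : ℕ) : ℝ :=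
  Real.Gamma (k + 1 / t) / (k.factorial * Real.Gamma (1 / t)) * (θ * t) ^ k /
    (1 + θ * t) ^ ((k : ℝ) + 1 / t)

/-- The negative binomial distribution `Z(t,θ)`, as a measure on `ℝ`. -/
def negBinomialMeasure (t θ : ℝ) : Measure ℝ := discreteMeasure (negBinomialPMFReal t θ)

/-- Zero inflation: the mixture of the point mass at `0` with weight `p` and `μ` with
weight `1 - p`. -/
def ziMeasure (p : ℝ) (μ : Measure ℝ) : Measure ℝ :=
  ENNReal.ofReal p • Measure.dirac (0 : ℝ) + ENNReal.ofReal (1 - p) • μ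

/-- The zero-inflated Poisson distribution `Y(θ,p)`: mixture of the point mass at `0` with
weight `p` and the Poisson distribution with mean `θ/(1-p)` with weight `1-p`. -/
def ZIP (θ p : ℝ) : Measure ℝ := ziMeasure p (poissonMeasure (θ / (1 - p)))

/-- The zero-inflated binomial distribution `X(m,θ,p)`: mixture of the point mass at `0` with
weight `p` and the binomial distribution with parameters `m` and `θ/(m(1-p))` with
weight `1-p`. -/
def ZIB (m : ℕ) (θ p : ℝ) : Measure ℝ :=
  ziMeasure p (binomialMeasure m (θ / (m * (1 - p))))

/-- The zero-inflated negative binomial distribution of the first kind `Z₁(t,θ,p)`: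
mixture of the point mass at `0` with weight `p` and `Z(t(1-p), θ/(1-p))` with weight `1-p`. -/
def ZINB₁ (t θ p : ℝ) : Measure ℝ :=
  ziMeasure p (negBinomialMeasure (t * (1 - p)) (θ / (1 - p)))

/-- The zero-inflated negative binomial distribution of the second kind `Z₂(t,θ,p)`:
mixture of the point mass at `0` with weight `p` and `Z(t, θ/(1-p))` with weight `1-p`. -/
def ZINB₂ (t θ p : ℝ) : Measure ℝ :=
  ziMeasure p (negBinomialMeasure t (θ / (1 - p)))

/-- The probability mass function of the zero-inflated negative binomial
distribution `Z₂(t,θ,p)`. -/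
def zinb2PMFReal (t θ p : ℝ) (k : ℕ) : ℝ :=
  (if k = 0 then p else 0) + (1 - p) * negBinomialPMFReal t (θ / (1 - p)) k

/-- The expected value of the maximum of `k` independent copies of a random variable with
distribution `μ`. -/
def expMax (μ : Measure ℝ) (k : ℕ) : ℝ :=
  ∫ x : Fin k → ℝ, (⨆ i, x i) ∂(Measure.pi fun _ => μ)

/-- The expected value of the minimum of `k` independent copies of a random variable with
distribution `μ`. -/
def expMin (μ : Measure ℝ) (k : ℕ) : ℝ :=
  ∫ x : Fin k → ℝ, (⨅ i, x i) ∂(Measure.pi fun _ => μ)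

/-- The modified Bessel function of the first kind of integer order `n`. -/
def besselI (n : ℕ) (x : ℝ) : ℝ :=
  ∑' j : ℕ, (x / 2) ^ (2 * j + n) / (j.factorial * (j + n).factorial)

/-- `M₂ θ`: the expected value of the maximum of two independent Poisson random variables
with mean `θ`. -/
def M₂ (x : ℝ) : ℝ := x + x * Real.exp (-2 * x) * (besselI 0 (2 * x) + besselI 1 (2 * x))

/-- The discrepancy `Δ₂:₂(θ,p) = 2pθ + (1-p)² M₂(θ/(1-p)) − M₂(θ)`. -/
def Δdisc (θ p : ℝ) : ℝ := 2 * p * θ + (1 - p) ^ 2 * M₂ (θ / (1 - p)) - M₂ θ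

/-- The asymptotic variance `σ²(θ)` of `√n Δ₂:₂` under the Poisson null hypothesis. -/
def σsq (θ : ℝ) : ℝ :=
  θ ^ 2 * (1 - Real.exp (-2 * θ) *
      ((1 + θ) * besselI 0 (2 * θ) - besselI 1 (2 * θ) + θ * besselI 2 (2 * θ))) ^ 2 /
    (Real.exp θ - 1 - θ)


/-- On the natural numbers, a convex function lies below the line through `(a, φ a)` and
`(b, φ b)` between `a` and `b`, and above it elsewhere. Hence it correlates nonnegatively with
any sequence of total mass and first moment zero whose nonpositive values occupy an interval. -/
theorem tsum_mul_nonneg_of_sign_pattern {φ : ℝ → ℝ} (hφ : ConvexOn ℝ Set.univ φ) {d : ℕ → ℝ}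
    (hd₀ : HasSum d 0) (hd₁ : HasSum (fun k : ℕ => (k : ℝ) * d k) 0)
    (hd : ∀ k n m, k ≤ n → n ≤ m → d k ≤ 0 → d m ≤ 0 → d n ≤ 0)
    (hs : Summable fun k => d k * φ k) : 0 ≤ ∑' k, d k * φ k := by
  classical
  have hlin (m c : ℝ) : HasSum (fun k => d k * (m * k + c)) 0 := by
    have h := (hd₁.mul_left m).add (hd₀.mul_left c)
    simp only [mul_zero, add_zero] at h
    exact h.congr_fun (fun k => by ring)
  have hne : ∃ k, d k ≤ 0 := by
    by_contra! h
    exact (h 0).ne' ((hasSum_zero_iff_of_nonneg fun k => (h k).le).1 hd₀ ▸ rfl)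
  obtain ⟨a, ha, hmin⟩ : ∃ a, d a ≤ 0 ∧ ∀ k < a, 0 < d k :=
    ⟨Nat.find hne, Nat.find_spec hne, fun k hk => not_le.1 (Nat.find_min hne hk)⟩
  by_cases hb : ∃ b, a < b ∧ ∀ k, b < k → 0 < d k
  · obtain ⟨hab, hbk⟩ := Nat.find_spec hb
    have hbmin := fun k => Nat.find_min hb (m := k)
    generalize Nat.find hb = b at hab hbk hbmin
    have hmid : ∀ k, a < k → k < b → d k ≤ 0 := by
      intro k hak hkb
      by_contra! hk
      refine hbmin k hkb ⟨hak, fun j hj => ?_⟩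
      by_contra! hj'
      exact hk.not_ge (hd a k j hak.le hj.le ha hj')
    have hab' : (a : ℝ) < b := by exact_mod_cast hab
    set m : ℝ := (φ b - φ a) / (b - a) with hm
    have hmb : m * (b - a) = φ b - φ a := div_mul_cancel₀ _ (sub_pos.2 hab').ne'
    have hterm : ∀ k, 0 ≤ d k * φ k - d k * (m * k + (φ a - m * a)) := by
      intro k
      rw [← mul_sub]
      rcases lt_trichotomy k a with hk | rfl | hk
      · have hk' : (k : ℝ) < a := by exact_mod_cast hk
        refine mul_nonneg (hmin k hk).le ?_
        have h := hφ.slope_mono_adjacent (Set.mem_univ (k : ℝ)) (Set.mem_univ (b : ℝ)) hk' hab'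
        rw [← hm, div_le_iff₀ (sub_pos.2 hk')] at h
        linarith
      · simp
      · have hk' : (a : ℝ) < k := by exact_mod_cast hk
        rcases lt_trichotomy k b with hk2 | rfl | hk2
        · have hk2' : (k : ℝ) < b := by exact_mod_cast hk2
          refine mul_nonneg_of_nonpos_of_nonpos (hmid k hk hk2) ?_
          have h := hφ.secant_mono_aux2 (Set.mem_univ (a : ℝ)) (Set.mem_univ (b : ℝ)) hk' hk2'
          rw [← hm, div_le_iff₀ (sub_pos.2 hk')] at h
          linarith
        · rw [show φ k - (m * k + (φ a - m * a)) = 0 by linarith, mul_zero]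
        · have hk2' : (b : ℝ) < k := by exact_mod_cast hk2
          refine mul_nonneg (hbk k hk2).le ?_
          have h := hφ.secant_mono_aux2 (Set.mem_univ (a : ℝ)) (Set.mem_univ (k : ℝ)) hab' hk2'
          rw [← hm, le_div_iff₀ (sub_pos.2 hk')] at h
          linarith
    have h := hs.hasSum.sub (hlin m (φ a - m * a))
    rw [sub_zero] at h
    exact h.nonneg hterm
  · push Not at hb
    have htail : ∀ k, a ≤ k → d k ≤ 0 := by
      intro k hk
      obtain ⟨j, hj, hdj⟩ := hb (k + 1) (by omega)
      exact hd a k j hk (by omega) ha hdj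
    have hzero : (fun k => -(d k * (1 * k + -a))) = 0 := by
      refine (hasSum_zero_iff_of_nonneg fun k => ?_).1 (by simpa using (hlin 1 (-a)).neg)
      rcases lt_or_ge k a with hk | hk
      · have : (k : ℝ) ≤ a := by exact_mod_cast hk.le
        nlinarith [hmin k hk]
      · have : (a : ℝ) ≤ k := by exact_mod_cast hk
        nlinarith [htail k hk]
    have hoff : ∀ k, k ≠ a → d k = 0 := by
      intro k hk
      have h := congrFun hzero k
      simp only [Pi.zero_apply, neg_eq_zero, mul_eq_zero] at h
      refine h.resolve_right fun h' => hk ?_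
      have : (k : ℝ) = a := by linarith
      exact_mod_cast this
    have hda : d a = 0 := (hasSum_single a hoff).unique hd₀
    have : ∀ k : ℕ, d k = 0 := fun k => (eq_or_ne k a).elim (fun h => h ▸ hda) (hoff k)
    simp [this]

theorem Ring.multichoose_eq_Gamma_div {a : ℝ} (ha : 0 < a) (n : ℕ) :
    Ring.multichoose a n = Real.Gamma (n + a) / (n.factorial * Real.Gamma a) := by
  have hG := (Real.Gamma_pos_of_pos ha).ne'
  have hf : (n.factorial : ℝ) ≠ 0 := by positivity
  have h := Ring.factorial_nsmul_multichoose_eq_ascPochhammer a n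
  rw [Polynomial.ascPochhammer_smeval_eq_eval, nsmul_eq_mul] at h
  have key : ∀ n : ℕ, Real.Gamma (n + a) = (ascPochhammer ℝ n).eval a * Real.Gamma a := by
    intro n
    induction n with
    | zero => simp
    | succ n ih =>
      rw [ascPochhammer_succ_eval, Nat.cast_succ, add_right_comm,
        Real.Gamma_add_one (by positivity), ih]
      ring
  rw [eq_div_iff (by positivity), key, ← h]
  ring

theorem hasSum_Gamma_div_mul_pow {a x : ℝ} (ha : 0 < a) (hx : |x| < 1) :
    HasSum (fun k : ℕ => Real.Gamma (k + a) / (k.factorial * Real.Gamma a) * x ^ k)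
      (1 / (1 - x) ^ a) := by
  have h := (Real.one_div_one_sub_rpow_hasFPowerSeriesOnBall_zero a).hasSum (y := x) (by
    simpa [enorm_eq_nnnorm, ← NNReal.coe_lt_coe] using hx)
  simp only [FormalMultilinearSeries.ofScalars_apply_eq, zero_add, smul_eq_mul] at h
  exact h.congr_fun fun k => by rw [← Ring.multichoose_eq_Gamma_div ha, Ring.multichoose_eq]

section NegBinomial

variable {t θ : ℝ}

theorem negBinomialPMFReal_pos (ht : 0 < t) (hθ : 0 < θ) (k : ℕ) :
    0 < negBinomialPMFReal t θ k := by
  have h₁ := Real.Gamma_pos_of_pos (show 0 < (k : ℝ) + 1 / t by positivity)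
  have h₂ := Real.Gamma_pos_of_pos (show 0 < 1 / t by positivity)
  unfold negBinomialPMFReal
  positivity

theorem negBinomialPMFReal_succ (ht : 0 < t) (hθ : 0 < θ) (k : ℕ) :
    negBinomialPMFReal t θ (k + 1) =
      negBinomialPMFReal t θ k * (θ * (k * t + 1) / ((k + 1) * (1 + θ * t))) := by
  have h₂ := (Real.Gamma_pos_of_pos (show 0 < 1 / t by positivity)).ne'
  have hb : 0 < 1 + θ * t := by positivity
  have hr := (Real.rpow_pos_of_pos hb (k + 1 / t)).ne'
  unfold negBinomialPMFReal
  rw [Nat.cast_succ, add_right_comm, Real.Gamma_add_one (by positivity), Real.rpow_add_one hb.ne',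
    Nat.factorial_succ, pow_succ]
  push_cast
  field_simp

theorem negBinomialPMFReal_eq (ht : 0 < t) (hθ : 0 < θ) (k : ℕ) :
    negBinomialPMFReal t θ k = Real.Gamma (k + 1 / t) / (k.factorial * Real.Gamma (1 / t)) *
      (θ * t / (1 + θ * t)) ^ k * (1 - θ * t / (1 + θ * t)) ^ (1 / t) := by
  have hb : 0 < 1 + θ * t := by positivity
  rw [show 1 - θ * t / (1 + θ * t) = (1 + θ * t)⁻¹ by field_simp; ring, Real.inv_rpow hb.le,
    negBinomialPMFReal, Real.rpow_add hb, Real.rpow_natCast, div_pow]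
  field_simp

theorem hasSum_negBinomialPMFReal (ht : 0 < t) (hθ : 0 < θ) :
    HasSum (negBinomialPMFReal t θ) 1 := by
  have hx : θ * t / (1 + θ * t) < 1 := by rw [div_lt_one (by positivity)]; linarith
  have h := (hasSum_Gamma_div_mul_pow (a := 1 / t) (by positivity)
    (abs_lt.2 ⟨(neg_one_lt_zero.trans (by positivity)), hx⟩)).mul_right
      ((1 - θ * t / (1 + θ * t)) ^ (1 / t))
  rw [one_div_mul_cancel (Real.rpow_pos_of_pos (sub_pos.2 hx) _).ne'] at h
  exact h.congr_fun (negBinomialPMFReal_eq ht hθ)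

theorem hasSum_mul_negBinomialPMFReal (ht : 0 < t) (hθ : 0 < θ) :
    HasSum (fun k : ℕ => (k : ℝ) * negBinomialPMFReal t θ k) θ := by
  have hx : θ * t / (1 + θ * t) < 1 := by rw [div_lt_one (by positivity)]; linarith
  have ha : 0 < 1 / t := by positivity
  have h := (hasSum_Gamma_div_mul_pow (a := 1 / t + 1) (by positivity)
    (abs_lt.2 ⟨(neg_one_lt_zero.trans (by positivity)), hx⟩)).mul_right
      (1 / t * (θ * t / (1 + θ * t)) * (1 - θ * t / (1 + θ * t)) ^ (1 / t))
  have hr := (Real.rpow_pos_of_pos (sub_pos.2 hx) (1 / t)).ne'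
  have hG := (Real.Gamma_pos_of_pos ha).ne'
  have hval : 1 / (1 - θ * t / (1 + θ * t)) ^ (1 / t + 1) *
      (1 / t * (θ * t / (1 + θ * t)) * (1 - θ * t / (1 + θ * t)) ^ (1 / t)) = θ := by
    rw [Real.rpow_add_one (sub_pos.2 hx).ne']
    generalize (1 - θ * t / (1 + θ * t)) ^ (1 / t) = r at hr
    rw [show 1 - θ * t / (1 + θ * t) = (1 + θ * t)⁻¹ by field_simp; ring]
    field_simp
  rw [hval] at h
  rw [← hasSum_nat_add_iff' 1]
  simp only [Finset.range_one, Finset.sum_singleton, Nat.cast_zero, zero_mul, sub_zero]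
  refine h.congr_fun fun k => ?_
  rw [negBinomialPMFReal_eq ht hθ, Real.Gamma_add_one ha.ne', Nat.factorial_succ, Nat.cast_succ,
    add_right_comm, add_assoc (k : ℝ)]
  generalize (1 - θ * t / (1 + θ * t)) ^ (1 / t) = r
  generalize θ * t / (1 + θ * t) = x
  push_cast
  field_simp
  ring

end NegBinomial

theorem hasSum_integral_discreteMeasure {w : ℕ → ℝ} (hw : ∀ k, 0 ≤ w k) {φ : ℝ → ℝ}
    (hφ : Integrable φ (discreteMeasure w)) :
    HasSum (fun k => w k * φ k) (∫ x, φ x ∂discreteMeasure w) := by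
  have h := hasSum_integral_measure hφ
  simpa [ENNReal.toReal_ofReal, hw] using! h

/-- The likelihood ratio of two negative binomial distributions with common mean `θ` decreases
below `θ` and increases above it. -/
theorem negBinomialPMFReal_sub_nonpos_of_between {θ t₁ t₂ : ℝ} (hθ : 0 < θ) (ht₁ : 0 < t₁)
    (ht₁₂ : t₁ < t₂) {k n m : ℕ} (hkn : k ≤ n) (hnm : n ≤ m)
    (hk : negBinomialPMFReal t₂ θ k ≤ negBinomialPMFReal t₁ θ k)
    (hm : negBinomialPMFReal t₂ θ m ≤ negBinomialPMFReal t₁ θ m) :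
    negBinomialPMFReal t₂ θ n ≤ negBinomialPMFReal t₁ θ n := by
  have ht₂ := ht₁.trans ht₁₂
  have hup : ∀ j : ℕ, (j : ℝ) ≤ θ → negBinomialPMFReal t₂ θ j ≤ negBinomialPMFReal t₁ θ j →
      negBinomialPMFReal t₂ θ (j + 1) ≤ negBinomialPMFReal t₁ θ (j + 1) := by
    intro j hj h
    rw [negBinomialPMFReal_succ ht₁ hθ, negBinomialPMFReal_succ ht₂ hθ]
    refine mul_le_mul h ?_ (by positivity) (negBinomialPMFReal_pos ht₁ hθ j).le
    rw [div_le_div_iff₀ (by positivity) (by positivity)]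
    have : 0 ≤ (θ - j) * (t₂ - t₁) * (θ * (j + 1)) := by
      have := sub_nonneg.2 hj
      have := sub_pos.2 ht₁₂
      positivity
    linarith
  have hdown : ∀ j : ℕ, θ ≤ j → negBinomialPMFReal t₂ θ (j + 1) ≤ negBinomialPMFReal t₁ θ (j + 1) →
      negBinomialPMFReal t₂ θ j ≤ negBinomialPMFReal t₁ θ j := by
    intro j hj h
    contrapose! h
    rw [negBinomialPMFReal_succ ht₁ hθ, negBinomialPMFReal_succ ht₂ hθ]
    refine mul_lt_mul h ?_ (by positivity) (negBinomialPMFReal_pos ht₂ hθ j).le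
    rw [div_le_div_iff₀ (by positivity) (by positivity)]
    have : 0 ≤ (j - θ) * (t₂ - t₁) * (θ * (j + 1)) := by
      have := sub_nonneg.2 hj
      have := sub_pos.2 ht₁₂
      positivity
    linarith
  rcases le_total (n : ℝ) θ with hn | hn
  · induction n, hkn using Nat.le_induction with
    | base => exact hk
    | succ j hj ih =>
      push_cast at hn
      exact hup j (by linarith) (ih (by omega) (by linarith))
  · clear hk hkn
    induction m, hnm using Nat.le_induction with
    | base => exact hm
    | succ j hj ih => exact ih (hdown j (hn.trans (by exact_mod_cast hj)) hm)

theorem negBinomialMeasure_convexOrder {θ t₁ t₂ : ℝ} (hθ : 0 < θ) (ht₁ : 0 < t₁) (ht₁₂ : t₁ < t₂) :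
    ConvexOrder (negBinomialMeasure t₁ θ) (negBinomialMeasure t₂ θ) := by
  intro φ hφ h₁ h₂
  have ht₂ := ht₁.trans ht₁₂
  have hs₁ := hasSum_integral_discreteMeasure (fun k => (negBinomialPMFReal_pos ht₁ hθ k).le) h₁
  have hs₂ := hasSum_integral_discreteMeasure (fun k => (negBinomialPMFReal_pos ht₂ hθ k).le) h₂
  have hd₀ := (hasSum_negBinomialPMFReal ht₂ hθ).sub (hasSum_negBinomialPMFReal ht₁ hθ)
  have hd₁ := (hasSum_mul_negBinomialPMFReal ht₂ hθ).sub (hasSum_mul_negBinomialPMFReal ht₁ hθ)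
  have hs := hs₂.sub hs₁
  simp only [sub_self, ← mul_sub, ← sub_mul] at hd₀ hd₁ hs
  have h := tsum_mul_nonneg_of_sign_pattern hφ hd₀ hd₁ (fun k n m hkn hnm hk hm =>
    sub_nonpos.2 (negBinomialPMFReal_sub_nonpos_of_between hθ ht₁ ht₁₂ hkn hnm
      (sub_nonpos.1 hk) (sub_nonpos.1 hm))) hs.summable
  rw [hs.tsum_eq] at h
  exact sub_nonneg.1 h

theorem ConvexOrder.ziMeasure {μ ν : Measure ℝ} (h : ConvexOrder μ ν) {p : ℝ} (hp : p < 1) :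
    ConvexOrder (ziMeasure p μ) (ziMeasure p ν) := by
  intro φ hφ h₁ h₂
  have hc : ENNReal.ofReal (1 - p) ≠ 0 := by simpa using hp
  obtain ⟨h₀, h₁⟩ := integrable_add_measure.1 h₁
  obtain ⟨-, h₂⟩ := integrable_add_measure.1 h₂
  simp only [_root_.ziMeasure]
  rw [integral_add_measure h₀ h₁, integral_add_measure h₀ h₂, integral_smul_measure φ _ (μ := μ),
    integral_smul_measure φ _ (μ := ν)]
  have := h φ hφ ((integrable_smul_measure hc ENNReal.ofReal_ne_top).1 h₁)
    ((integrable_smul_measure hc ENNReal.ofReal_ne_top).1 h₂)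
  gcongr

/-- For every fixed `0 ≤ p < 1`, every `θ > 0` and all `0 < t₁ < t₂`, the
zero-inflated negative binomial distributions satisfy `Z₁(t₁,θ,p) ≤cx Z₁(t₂,θ,p)` and
`Z₂(t₁,θ,p) ≤cx Z₂(t₂,θ,p)`. -/
theorem zinb_convexOrder_of_t_le (p : ℝ) (hp₀ : 0 ≤ p) (hp₁ : p < 1)
    (θ t₁ t₂ : ℝ) (hθ : 0 < θ) (ht₁ : 0 < t₁) (ht₁₂ : t₁ < t₂) :
    ConvexOrder (ZINB₁ t₁ θ p) (ZINB₁ t₂ θ p) ∧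
      ConvexOrder (ZINB₂ t₁ θ p) (ZINB₂ t₂ θ p) := by
  have h := sub_pos.2 hp₁
  exact ⟨(negBinomialMeasure_convexOrder (by positivity) (by positivity) (by gcongr)).ziMeasure hp₁,
    (negBinomialMeasure_convexOrder (by positivity) ht₁ ht₁₂).ziMeasure hp₁⟩

end
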